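/- For every integer t ≥ 5 there exist real constants c, C > 0 and an integer M such that for every integer m ≥ M: every (3,t)-system (H,F) with |H| = m satisfies |F| ≤ C·m^{t-3}, and there exists a (3,t)-system (H,F) with |H| = m and |F| ≥ c·m^{(t-1)/2}. -/

import Mathlib

open SimpleGraph

/-- `G` is `K_r`-saturated: `G` contains no `r`-clique, but adding any missing edge
creates an `r`-clique. -/
def Ksat (r : ℕ) {V : Type*} (G : SimpleGraph V) : Prop :=
  G.CliqueFree r ∧ ∀ u v : V, u ≠ v → ¬ G.Adj u v →
    ¬ (G ⊔ fromEdgeSet {s(u, v)}).CliqueFree r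

/-- `G` is twin-free: distinct vertices have distinct neighbourhoods. -/
def TwinFree {V : Type*} (G : SimpleGraph V) : Prop :=
  ∀ u v : V, G.neighborSet u = G.neighborSet v → u = v

/-- Minimum degree of `G` is at least `t`. -/
def MinDegGe {V : Type*} (G : SimpleGraph V) (t : ℕ) : Prop :=
  ∀ v : V, t ≤ (G.neighborSet v).ncard

/-- Every pair of distinct twins has a common neighbour of degree exactly `t`. -/
def TwinCond {V : Type*} (G : SimpleGraph V) (t : ℕ) : Prop :=
  ∀ u v : V, u ≠ v → G.neighborSet u = G.neighborSet v →
    ∃ w : V, (G.neighborSet w).ncard = t ∧ G.Adj w u ∧ G.Adj w v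

/-- An `(r,t)`-system. -/
def IsRTSystem (r t : ℕ) {V : Type*} [DecidableEq V] (H : SimpleGraph V)
    (F : Finset (Finset V)) : Prop :=
  H.CliqueFree r ∧
  (∀ S ∈ F, S.card = t ∧
    (H.induce (S : Set V)).CliqueFree (r - 1) ∧
    ∀ v : V, v ∉ S → ¬ (H.induce ((insert v S : Finset V) : Set V)).CliqueFree (r - 1)) ∧
  (∀ S ∈ F, ∀ T ∈ F, S ≠ T → ¬ (H.induce ((S ∩ T : Finset V) : Set V)).CliqueFree (r - 2))

/-- A maximal `(r,t)`-system. -/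
def IsMaxRTSystem (r t : ℕ) {V : Type*} [DecidableEq V] (H : SimpleGraph V)
    (F : Finset (Finset V)) : Prop :=
  IsRTSystem r t H F ∧
  ∀ u v : V, u ≠ v → ¬ H.Adj u v →
    ¬ (H ⊔ fromEdgeSet {s(u, v)}).CliqueFree r ∨
    ∃ S ∈ F, ¬ (((H ⊔ fromEdgeSet {s(u, v)}).induce (S : Set V)).CliqueFree (r - 1))

/-- A `(3,t)`-system. -/
def Is3TSystem (t : ℕ) {V : Type*} [DecidableEq V] (H : SimpleGraph V)
    (F : Finset (Finset V)) : Prop :=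
  H.CliqueFree 3 ∧
  (∀ S ∈ F, S.card = t ∧
    (∀ u ∈ S, ∀ v ∈ S, ¬ H.Adj u v) ∧
    (∀ v : V, v ∉ S → ∃ u ∈ S, H.Adj v u)) ∧
  (∀ S ∈ F, ∀ T ∈ F, S ≠ T → (S ∩ T).Nonempty)

/-- A maximal `(3,t)`-system. -/
def IsMax3TSystem (t : ℕ) {V : Type*} [DecidableEq V] (H : SimpleGraph V)
    (F : Finset (Finset V)) : Prop :=
  Is3TSystem t H F ∧
  ∀ u v : V, u ≠ v → ¬ H.Adj u v →
    ¬ (H ⊔ fromEdgeSet {s(u, v)}).CliqueFree 3 ∨ ∃ S ∈ F, u ∈ S ∧ v ∈ S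

noncomputable def s3 (t m : ℕ) : ℕ :=
  sSup {a : ℕ | ∃ (H : SimpleGraph (Fin m)) (F : Finset (Finset (Fin m))),
    Is3TSystem t H F ∧ F.card = a}

noncomputable def ePrime (r t s : ℕ) : ℕ :=
  sInf {e : ℕ | ∃ (m : ℕ) (H : SimpleGraph (Fin m)) (F : Finset (Finset (Fin m))),
    IsMaxRTSystem r t H F ∧ F.card = s ∧ H.edgeSet.ncard = e}

noncomputable def e3min (t s : ℕ) : ℕ :=
  sInf {e : ℕ | ∃ (m : ℕ) (H : SimpleGraph (Fin m)) (F : Finset (Finset (Fin m))),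
    Is3TSystem t H F ∧ F.card = s ∧ H.edgeSet.ncard = e}

/-- In a triangle-free graph, a pair of vertices lies in at most two members of a family of
independent triples that dominate `W`. -/
lemma card_filter_pair_le_two {V : Type*} [DecidableEq V] {H : SimpleGraph V} {W : Finset V}
    {G : Finset (Finset V)}
    (htri : ∀ a b c, H.Adj a b → H.Adj b c → H.Adj a c → False)
    (hcard : ∀ S ∈ G, S.card = 3) (hW : ∀ S ∈ G, S ⊆ W)
    (hind : ∀ S ∈ G, ∀ u ∈ S, ∀ v ∈ S, ¬ H.Adj u v)
    (hdom : ∀ S ∈ G, ∀ v ∈ W, v ∉ S → ∃ u ∈ S, H.Adj v u)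
    {p w : V} (hpw : p ≠ w) :
    (G.filter (fun S => p ∈ S ∧ w ∈ S)).card ≤ 2 := by
  have third : ∀ S ∈ G, p ∈ S → w ∈ S → ∃ z, S = {p, w, z} := by
    intro S hS hp hw
    have h1 : ({p, w} : Finset V) ⊆ S := by
      intro x hx
      simp only [Finset.mem_insert, Finset.mem_singleton] at hx
      rcases hx with rfl | rfl <;> assumption
    have h2 : (S \ {p, w}).card = 1 := by
      rw [Finset.card_sdiff_of_subset h1, hcard S hS, Finset.card_pair hpw]
    obtain ⟨z, hz⟩ := Finset.card_eq_one.1 h2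
    refine ⟨z, ?_⟩
    rw [← Finset.union_sdiff_of_subset h1, hz]
    ext x
    simp
  have adj : ∀ z z', z ≠ z' → ({p, w, z} : Finset V) ∈ G → ({p, w, z'} : Finset V) ∈ G →
      H.Adj z z' := by
    intro z z' hzz h h'
    have hz : z ∈ W := hW _ h (by simp)
    have hi := hind _ h
    have hc := hcard _ h
    have hzp : z ≠ p := by
      rintro rfl
      have : ({z, w, z} : Finset V).card ≤ 2 := by
        rw [show ({z, w, z} : Finset V) = {z, w} by ext; simp; tauto]
        exact Finset.card_le_two
      omega
    have hzw : z ≠ w := by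
      rintro rfl
      have : ({p, z, z} : Finset V).card ≤ 2 := by
        rw [show ({p, z, z} : Finset V) = {p, z} by ext; simp]
        exact Finset.card_le_two
      omega
    obtain ⟨u, hu, huz⟩ := hdom _ h' z hz (by simp [hzz, hzp, hzw])
    simp only [Finset.mem_insert, Finset.mem_singleton] at hu
    rcases hu with rfl | rfl | rfl
    · exact absurd huz (hi _ (by simp) _ (by simp))
    · exact absurd huz (hi _ (by simp) _ (by simp))
    · exact huz
  by_contra hlt
  obtain ⟨S₁, h₁, S₂, h₂, S₃, h₃, h₁₂, h₁₃, h₂₃⟩ := Finset.two_lt_card.1 (not_le.1 hlt)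
  simp only [Finset.mem_filter] at h₁ h₂ h₃
  obtain ⟨z₁, rfl⟩ := third _ h₁.1 h₁.2.1 h₁.2.2
  obtain ⟨z₂, rfl⟩ := third _ h₂.1 h₂.2.1 h₂.2.2
  obtain ⟨z₃, rfl⟩ := third _ h₃.1 h₃.2.1 h₃.2.2
  have n₁₂ : z₁ ≠ z₂ := by rintro rfl; exact h₁₂ rfl
  have n₁₃ : z₁ ≠ z₃ := by rintro rfl; exact h₁₃ rfl
  have n₂₃ : z₂ ≠ z₃ := by rintro rfl; exact h₂₃ rfl
  exact htri _ _ _ (adj _ _ n₁₂ h₁.1 h₂.1) (adj _ _ n₂₃ h₂.1 h₃.1) (adj _ _ n₁₃ h₁.1 h₃.1)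

/-- If `p` lies in many members of `G`, one of them avoids a given small set. -/
lemma exists_triple_avoiding {V : Type*} [DecidableEq V] {G : Finset (Finset V)}
    (hcard : ∀ S ∈ G, S.card = 3) {p : V}
    (hpair : ∀ w, p ≠ w → (G.filter (fun S => p ∈ S ∧ w ∈ S)).card ≤ 2)
    {B : Finset V} (hpB : p ∉ B) (hdeg : B.card * 2 < (G.filter (fun S => p ∈ S)).card) :
    ∃ u v, ({p, u, v} : Finset V) ∈ G ∧ u ∉ B ∧ v ∉ B ∧ p ≠ u ∧ p ≠ v := by
  obtain ⟨S, hS, hp, hd⟩ : ∃ S ∈ G, p ∈ S ∧ ∀ w ∈ B, w ∉ S := by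
    by_contra! hno
    have hsub : G.filter (fun S => p ∈ S) ⊆
        B.biUnion (fun w => G.filter (fun S => p ∈ S ∧ w ∈ S)) := by
      intro S hS
      rw [Finset.mem_filter] at hS
      obtain ⟨w, hw, hwS⟩ := hno S hS.1 hS.2
      exact Finset.mem_biUnion.2 ⟨w, hw, Finset.mem_filter.2 ⟨hS.1, hS.2, hwS⟩⟩
    have := (Finset.card_le_card hsub).trans (Finset.card_biUnion_le_card_mul _ _ 2
      (fun w hw => hpair w (by rintro rfl; exact hpB hw)))
    omega
  have h2 : (S.erase p).card = 2 := by rw [Finset.card_erase_of_mem hp, hcard S hS]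
  obtain ⟨u, v, -, huv⟩ := Finset.card_eq_two.1 h2
  have hu : u ∈ S.erase p := by simp [huv]
  have hv : v ∈ S.erase p := by simp [huv]
  rw [Finset.mem_erase] at hu hv
  refine ⟨u, v, ?_, fun h => hd u h hu.2, fun h => hd v h hv.2, hu.1.symm, hv.1.symm⟩
  rw [← huv, Finset.insert_erase hp]
  exact hS

/-- If `p` lies in many members of `G`, the remaining two vertices of a triple through `p` can be
exchanged for two new vertices, each adjacent to exactly one of the old ones. -/
lemma exists_exchange {V : Type*} [DecidableEq V] {H : SimpleGraph V} {W : Finset V}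
    {G : Finset (Finset V)}
    (htri : ∀ a b c, H.Adj a b → H.Adj b c → H.Adj a c → False)
    (hcard : ∀ S ∈ G, S.card = 3) (hW : ∀ S ∈ G, S ⊆ W)
    (hind : ∀ S ∈ G, ∀ u ∈ S, ∀ v ∈ S, ¬ H.Adj u v)
    (hdom : ∀ S ∈ G, ∀ v ∈ W, v ∉ S → ∃ u ∈ S, H.Adj v u)
    {p q r : V} (hpq : p ≠ q) (hpr : p ≠ r) (hS : ({p, q, r} : Finset V) ∈ G)
    (hdeg : 12 < (G.filter (fun S => p ∈ S)).card)
    {B : Finset V} (hpB : p ∉ B) (hB : B.card ≤ 4) :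
    ∃ u v, ({p, u, v} : Finset V) ∈ G ∧ u ∉ B ∧ v ∉ B ∧
      H.Adj u r ∧ ¬ H.Adj u q ∧ H.Adj v q ∧ ¬ H.Adj v r ∧ ¬ H.Adj u p ∧ ¬ H.Adj v p := by
  have hpair : ∀ w, p ≠ w → (G.filter (fun S => p ∈ S ∧ w ∈ S)).card ≤ 2 :=
    fun w hw => card_filter_pair_le_two htri hcard hW hind hdom hw
  have dom : ∀ a b x, ({p, a, b} : Finset V) ∈ G → x ∈ W → x ≠ p → x ≠ a → x ≠ b →
      ¬ H.Adj x p → H.Adj x a ∨ H.Adj x b := by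
    intro a b x h hx hxp hxa hxb hn
    obtain ⟨u, hu, hxu⟩ := hdom _ h x hx (by simp [hxp, hxa, hxb])
    simp only [Finset.mem_insert, Finset.mem_singleton] at hu
    rcases hu with rfl | rfl | rfl
    · exact absurd hxu hn
    · exact Or.inl hxu
    · exact Or.inr hxu
  have mW : ∀ a b, ({p, a, b} : Finset V) ∈ G → a ∈ W ∧ b ∈ W := fun a b h =>
    ⟨hW _ h (by simp), hW _ h (by simp)⟩
  have nadj : ∀ a b, ({p, a, b} : Finset V) ∈ G → ¬ H.Adj a p ∧ ¬ H.Adj b p := fun a b h =>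
    ⟨hind _ h _ (by simp) _ (by simp), hind _ h _ (by simp) _ (by simp)⟩
  have hb : (insert q (insert r B)).card ≤ 6 :=
    (Finset.card_insert_le _ _).trans (by have := Finset.card_insert_le r B; omega)
  obtain ⟨u, v, huv, hu, hv, hpu, hpv⟩ := exists_triple_avoiding (B := insert q (insert r B))
    hcard hpair (by simp [hpq, hpr, hpB]) (by omega)
  have hb' : ({q, r, u, v} : Finset V).card ≤ 4 := Finset.card_le_four
  obtain ⟨a, b, hab, ha, hb, hpa, hpb⟩ := exists_triple_avoiding (B := {q, r, u, v})
    hcard hpair (by simp [hpq, hpr, hpu, hpv]) (by omega)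
  simp only [Finset.mem_insert, Finset.mem_singleton, not_or] at hu hv ha hb
  obtain ⟨huq, hur, huB⟩ := hu
  obtain ⟨hvq, hvr, hvB⟩ := hv
  obtain ⟨haq, har, hau, hav⟩ := ha
  obtain ⟨hbq, hbr, hbu, hbv⟩ := hb
  have ha' := dom q r a hS (mW _ _ hab).1 hpa.symm haq har (nadj _ _ hab).1
  have hb' := dom q r b hS (mW _ _ hab).2 hpb.symm hbq hbr (nadj _ _ hab).2
  have key : ∀ x, H.Adj x a ∨ H.Adj x b → H.Adj x q → H.Adj x r → False := by
    intro x hx hxq hxr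
    rcases hx with hx | hx
    · rcases ha' with h | h
      · exact htri _ _ _ hx h hxq
      · exact htri _ _ _ hx h hxr
    · rcases hb' with h | h
      · exact htri _ _ _ hx h hxq
      · exact htri _ _ _ hx h hxr
  have ku := key u (dom a b u hab (mW _ _ huv).1 hpu.symm (Ne.symm hau) (Ne.symm hbu)
    (nadj _ _ huv).1)
  have kv := key v (dom a b v hab (mW _ _ huv).2 hpv.symm (Ne.symm hav) (Ne.symm hbv)
    (nadj _ _ huv).2)
  have du := dom q r u hS (mW _ _ huv).1 hpu.symm huq hur (nadj _ _ huv).1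
  have dq := dom u v q huv (mW _ _ hS).1 hpq.symm (Ne.symm huq) (Ne.symm hvq) (nadj _ _ hS).1
  have dr := dom u v r huv (mW _ _ hS).2 hpr.symm (Ne.symm hur) (Ne.symm hvr) (nadj _ _ hS).2
  have hvu : ({p, v, u} : Finset V) ∈ G := by rwa [Finset.pair_comm v u]
  obtain ⟨nu, nv⟩ := nadj _ _ huv
  rcases du with h | h
  · have h1 : ¬ H.Adj u r := fun h' => ku h h'
    have h2 : H.Adj v r := (dr.resolve_left fun h' => h1 h'.symm).symm
    exact ⟨v, u, hvu, hvB, huB, h2, fun h' => kv h' h2, h, h1, nv, nu⟩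
  · have h1 : ¬ H.Adj u q := fun h' => ku h' h
    have h2 : H.Adj v q := (dq.resolve_left fun h' => h1 h'.symm).symm
    exact ⟨u, v, huv, huB, hvB, h, h1, h2, fun h' => kv h2 h', nu, nv⟩

/-- In a triangle-free graph, a family of independent triples of `W` that dominate `W` has
at most `12 |W|` members. -/
lemma card_dominating_triples_le {V : Type*} [DecidableEq V] {H : SimpleGraph V} {W : Finset V}
    {G : Finset (Finset V)}
    (htri : ∀ a b c, H.Adj a b → H.Adj b c → H.Adj a c → False)
    (hcard : ∀ S ∈ G, S.card = 3) (hW : ∀ S ∈ G, S ⊆ W)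
    (hind : ∀ S ∈ G, ∀ u ∈ S, ∀ v ∈ S, ¬ H.Adj u v)
    (hdom : ∀ S ∈ G, ∀ v ∈ W, v ∉ S → ∃ u ∈ S, H.Adj v u) :
    G.card ≤ W.card * 12 := by
  have small : ∀ S ∈ G, ∃ p ∈ S, (G.filter (fun S => p ∈ S)).card ≤ 12 := by
    intro S hS
    by_contra! hbig
    obtain ⟨p, q, r, hpq, hpr, hqr, rfl⟩ := Finset.card_eq_three.1 (hcard S hS)
    have hp := hbig p (by simp)
    have hq := hbig q (by simp)
    have hr := hbig r (by simp)
    have perm₁ : ({r, p, q} : Finset V) = {p, q, r} := by ext; simp; tauto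
    have perm₂ : ({q, p, r} : Finset V) = {p, q, r} := by ext; simp; tauto
    have ipq := hind _ hS p (by simp) q (by simp)
    have ipr := hind _ hS p (by simp) r (by simp)
    have iqr := hind _ hS q (by simp) r (by simp)
    obtain ⟨p₁, q₁, h₁, -, -, a₁, b₁, c₁, d₁, e₁, f₁⟩ := exists_exchange (B := ∅) htri hcard hW hind
      hdom hpr.symm hqr.symm (perm₁ ▸ hS) hr (by simp) (by simp)
    have np₁ : p ≠ p₁ := by rintro rfl; exact ipq a₁
    have np₂ : p ≠ q₁ := by rintro rfl; exact H.irrefl c₁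
    have nq₁ : q ≠ p₁ := by rintro rfl; exact H.irrefl a₁
    have nq₂ : q ≠ q₁ := by rintro rfl; exact ipq c₁.symm
    obtain ⟨q₂, r₂, h₂, k₂, l₂, a₂, b₂, c₂, d₂, e₂, f₂⟩ := exists_exchange (B := {p₁, q₁}) htri
      hcard hW hind hdom hpq hpr hS hp (by simp [np₁, np₂])
      (Finset.card_le_two.trans (by norm_num))
    have nq₃ : q ≠ q₂ := by rintro rfl; exact iqr a₂
    have nq₄ : q ≠ r₂ := by rintro rfl; exact H.irrefl c₂
    obtain ⟨p₃, r₃, h₃, k₃, l₃, a₃, b₃, c₃, d₃, e₃, f₃⟩ := exists_exchange (B := {p₁, q₁, q₂, r₂})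
      htri hcard hW hind hdom hpq.symm hqr (perm₂ ▸ hS) hq (by simp [nq₁, nq₂, nq₃, nq₄])
      Finset.card_le_four
    simp only [Finset.mem_insert, Finset.mem_singleton, not_or] at k₂ l₂ k₃ l₃
    have xy : H.Adj r₂ q₁ := by
      obtain ⟨u, hu, hx⟩ := hdom _ h₁ r₂ (hW _ h₂ (by simp)) (by
        simp only [Finset.mem_insert, Finset.mem_singleton, not_or]
        refine ⟨?_, l₂.1, l₂.2⟩
        rintro rfl
        exact iqr c₂.symm)
      simp only [Finset.mem_insert, Finset.mem_singleton] at hu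
      rcases hu with rfl | rfl | rfl
      · exact absurd hx d₂
      · exact (htri _ _ _ hx a₁ c₂).elim
      · exact hx
    have yz : H.Adj q₁ p₃ := by
      obtain ⟨u, hu, hx⟩ := hdom _ h₃ q₁ (hW _ h₁ (by simp)) (by
        simp only [Finset.mem_insert, Finset.mem_singleton, not_or]
        exact ⟨nq₂.symm, Ne.symm k₃.2.1, Ne.symm l₃.2.1⟩)
      simp only [Finset.mem_insert, Finset.mem_singleton] at hu
      rcases hu with rfl | rfl | rfl
      · exact absurd hx d₁
      · exact hx
      · exact (htri _ _ _ hx c₃ c₁).elim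
    have zx : H.Adj p₃ r₂ := by
      obtain ⟨u, hu, hx⟩ := hdom _ h₂ p₃ (hW _ h₃ (by simp)) (by
        simp only [Finset.mem_insert, Finset.mem_singleton, not_or]
        refine ⟨?_, k₃.2.2.1, k₃.2.2.2⟩
        rintro rfl
        exact ipr a₃)
      simp only [Finset.mem_insert, Finset.mem_singleton] at hu
      rcases hu with rfl | rfl | rfl
      · exact absurd hx b₃
      · exact (htri _ _ _ hx a₂ a₃).elim
      · exact hx
    exact htri _ _ _ xy yz zx.symm
  have hsub : G ⊆ (W.filter (fun p => (G.filter (fun S => p ∈ S)).card ≤ 12)).biUnion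
      (fun p => G.filter (fun S => p ∈ S)) := by
    intro S hS
    obtain ⟨p, hp, hd⟩ := small S hS
    exact Finset.mem_biUnion.2 ⟨p, Finset.mem_filter.2 ⟨hW S hS hp, hd⟩,
      Finset.mem_filter.2 ⟨hS, hp⟩⟩
  calc G.card ≤ _ := Finset.card_le_card hsub
    _ ≤ (W.filter (fun p => (G.filter (fun S => p ∈ S)).card ≤ 12)).card * 12 :=
        Finset.card_biUnion_le_card_mul _ _ _ (fun p hp => (Finset.mem_filter.1 hp).2)
    _ ≤ W.card * 12 := Nat.mul_le_mul_right _ (Finset.card_filter_le _ _)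

lemma SimpleGraph.CliqueFree.no_triangle {V : Type*} {H : SimpleGraph V} (h : H.CliqueFree 3)
    (a b c : V) (hab : H.Adj a b) (hbc : H.Adj b c) (hac : H.Adj a c) : False := by
  classical
  exact h {a, b, c} (is3Clique_triple_iff.2 ⟨hab, hac, hbc⟩)

/-- In a `(3,t)`-system, at most `12 m` sets contain a given `(t-3)`-set. -/
lemma Is3TSystem.card_filter_superset_le {V : Type*} [Fintype V] [DecidableEq V] {t : ℕ}
    {H : SimpleGraph V} {F : Finset (Finset V)} (h : Is3TSystem t H F) {T : Finset V}
    (hT : T.card + 3 = t) :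
    (F.filter (fun S => T ⊆ S)).card ≤ Fintype.card V * 12 := by
  classical
  obtain ⟨hfree, hF, -⟩ := h
  set W : Finset V := Finset.univ.filter (fun v => v ∉ T ∧ ∀ u ∈ T, ¬ H.Adj v u) with hWdef
  have hinj : Set.InjOn (fun S => S \ T) (F.filter (fun S => T ⊆ S) : Set (Finset V)) := by
    intro S hS S' hS' hSS
    simp only [Finset.coe_filter, Set.mem_ofPred_eq] at hS hS' hSS
    rw [← Finset.sdiff_union_of_subset hS.2, hSS, Finset.sdiff_union_of_subset hS'.2]
  rw [← Finset.card_image_of_injOn hinj]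
  refine le_trans (card_dominating_triples_le (H := H) (W := W) hfree.no_triangle ?_ ?_ ?_ ?_)
    (Nat.mul_le_mul_right _ (Finset.card_le_univ _))
  all_goals
    simp only [Finset.mem_image, Finset.mem_filter]
    rintro _ ⟨S, ⟨hS, hTS⟩, rfl⟩
    obtain ⟨hc, hi, hd⟩ := hF S hS
  · rw [Finset.card_sdiff_of_subset hTS]
    omega
  · intro v hv
    rw [Finset.mem_sdiff] at hv
    exact Finset.mem_filter.2 ⟨Finset.mem_univ _, hv.2, fun u hu => hi v hv.1 u (hTS hu)⟩
  · intro u hu v hv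
    exact hi u (Finset.mem_sdiff.1 hu).1 v (Finset.mem_sdiff.1 hv).1
  · intro v hv hvS
    rw [hWdef, Finset.mem_filter] at hv
    obtain ⟨u, hu, huv⟩ := hd v (fun h => hvS (Finset.mem_sdiff.2 ⟨h, hv.2.1⟩))
    exact ⟨u, Finset.mem_sdiff.2 ⟨hu, fun h => hv.2.2 u h huv⟩, huv⟩

lemma Is3TSystem.card_filter_superset_le_pow {V : Type*} [Fintype V] [DecidableEq V] {t : ℕ}
    {H : SimpleGraph V} {F : Finset (Finset V)} (h : Is3TSystem t H F) (j : ℕ) {T : Finset V}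
    (hT : T.card + 3 + j = t) :
    (F.filter (fun S => T ⊆ S)).card ≤ Fintype.card V ^ (j + 1) * 12 := by
  induction j generalizing T with
  | zero => simpa using h.card_filter_superset_le hT
  | succ j ih =>
    have hsub : F.filter (fun S => T ⊆ S) ⊆ (Finset.univ.filter (fun v => v ∉ T)).biUnion
        (fun v => F.filter (fun S => insert v T ⊆ S)) := by
      intro S hS
      rw [Finset.mem_filter] at hS
      have hc := (h.2.1 S hS.1).1
      obtain ⟨v, hvS, hvT⟩ := Finset.exists_mem_notMem_of_card_lt_card
        (show T.card < S.card by omega)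
      exact Finset.mem_biUnion.2 ⟨v, by simp [hvT],
        Finset.mem_filter.2 ⟨hS.1, Finset.insert_subset hvS hS.2⟩⟩
    calc _ ≤ _ := Finset.card_le_card hsub
      _ ≤ (Finset.univ.filter (fun v => v ∉ T)).card * (Fintype.card V ^ (j + 1) * 12) := by
          refine Finset.card_biUnion_le_card_mul _ _ _ (fun v hv => ih ?_)
          rw [Finset.card_insert_of_notMem (Finset.mem_filter.1 hv).2]
          omega
      _ ≤ Fintype.card V * (Fintype.card V ^ (j + 1) * 12) :=
          Nat.mul_le_mul_right _ (Finset.card_le_univ _)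
      _ = _ := by ring

/-- A `(3,t)`-system on `m` vertices has `O(m^(t-3))` sets. -/
lemma Is3TSystem.card_le {V : Type*} [Fintype V] [DecidableEq V] {t : ℕ} (ht : 4 ≤ t)
    {H : SimpleGraph V} {F : Finset (Finset V)} (h : Is3TSystem t H F) :
    F.card ≤ t * (Fintype.card V ^ (t - 3) * 12) := by
  rcases F.eq_empty_or_nonempty with rfl | ⟨S₀, hS₀⟩
  · simp
  have hsub : F ⊆ S₀.biUnion (fun v => F.filter (fun S => {v} ⊆ S)) := by
    intro S hS
    obtain ⟨v, hv, hv₀⟩ : ∃ v ∈ S, v ∈ S₀ := by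
      by_cases hne : S = S₀
      · subst hne
        obtain ⟨v, hv⟩ := Finset.card_pos.1 (show 0 < S.card by rw [(h.2.1 S hS).1]; omega)
        exact ⟨v, hv, hv⟩
      · obtain ⟨v, hv⟩ := h.2.2 S hS S₀ hS₀ hne
        exact ⟨v, Finset.mem_inter.1 hv⟩
    exact Finset.mem_biUnion.2 ⟨v, hv₀, Finset.mem_filter.2 ⟨hS, by simpa using hv⟩⟩
  calc F.card ≤ _ := Finset.card_le_card hsub
    _ ≤ S₀.card * (Fintype.card V ^ (t - 3) * 12) := by
        refine Finset.card_biUnion_le_card_mul _ _ _ (fun v _ => ?_)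
        have := h.card_filter_superset_le_pow (t - 4) (T := {v}) (by simp; omega)
        rwa [show t - 4 + 1 = t - 3 by omega] at this
    _ = _ := by rw [(h.2.1 S₀ hS₀).1]

/-- Being a `(3,t)`-system is invariant under relabelling the vertices. -/
lemma Is3TSystem.map_equiv {V V' : Type*} [DecidableEq V] [DecidableEq V'] {t : ℕ}
    {H : SimpleGraph V} {F : Finset (Finset V)} (h : Is3TSystem t H F) (e : V ≃ V') :
    Is3TSystem t (H.comap e.symm) (F.map (Finset.mapEmbedding e.toEmbedding).toEmbedding) := by
  obtain ⟨hfree, hF, hint⟩ := h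
  refine ⟨hfree.comap (Embedding.comap e.symm.toEmbedding H).isContained, ?_, ?_⟩
  · simp only [Finset.mem_map]
    rintro _ ⟨S, hS, rfl⟩
    obtain ⟨hc, hi, hd⟩ := hF S hS
    refine ⟨by simpa using hc, ?_, ?_⟩
    · intro u hu v hv
      simp only [RelEmbedding.coe_toEmbedding, Finset.mapEmbedding_apply,
        Finset.mem_map_equiv] at hu hv
      exact hi _ hu _ hv
    · intro v hv
      simp only [RelEmbedding.coe_toEmbedding, Finset.mapEmbedding_apply,
        Finset.mem_map_equiv] at hv
      obtain ⟨u, hu, huv⟩ := hd _ hv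
      exact ⟨e u, by simpa using hu, by simpa using huv⟩
  · simp only [Finset.mem_map]
    rintro _ ⟨S, hS, rfl⟩ _ ⟨S', hS', rfl⟩ hne
    obtain ⟨v, hv⟩ := hint S hS S' hS' (by rintro rfl; exact hne rfl)
    rw [Finset.mem_inter] at hv
    exact ⟨e v, by simpa using hv⟩

/-- A star with centre `0` and `r` leaves, together with a blow-up of the `s`-cycle whose `i`-th
part consists of pairs of labels; vertices in consecutive parts are adjacent when
their labels at the common index disagree. -/
def cycleLabelGraph (s k r : ℕ) (hs : 4 ≤ s) :
    SimpleGraph ((ZMod s × Fin k × Fin k) ⊕ Fin (r + 1)) where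
  Adj
    | .inl a, .inl b => (b.1 = a.1 + 1 ∧ a.2.2 ≠ b.2.1) ∨ (a.1 = b.1 + 1 ∧ b.2.2 ≠ a.2.1)
    | .inr i, .inr j => (i = 0 ∧ j ≠ 0) ∨ (j = 0 ∧ i ≠ 0)
    | _, _ => False
  symm := ⟨by
    rintro (a | i) (b | j) h
    · exact Or.symm h
    · exact h
    · exact h
    · exact Or.symm h⟩
  loopless := ⟨by
    have : Fact (1 < s) := ⟨by omega⟩
    rintro (a | i) h
    · rcases h with h | h <;> simp at h
    · rcases h with h | h <;> exact h.2 h.1⟩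

/-- The set of vertices of `cycleLabelGraph` selected by a labelling of the cycle. -/
def labelSet {s k : ℕ} [NeZero s] (r : ℕ) (x : ZMod s → Fin k) :
    Finset ((ZMod s × Fin k × Fin k) ⊕ Fin (r + 1)) :=
  insert (.inr 0) (Finset.univ.image fun i => .inl (i, x i, x (i + 1)))

lemma labelSet_injective {s k : ℕ} [NeZero s] (r : ℕ) :
    Function.Injective (labelSet (s := s) (k := k) r) := by
  intro x y hxy
  funext i
  have : (.inl (i, x i, x (i + 1)) : (ZMod s × Fin k × Fin k) ⊕ Fin (r + 1)) ∈ labelSet r x := by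
    simp [labelSet]
  rw [hxy] at this
  simp only [labelSet, Finset.mem_insert, reduceCtorEq, Finset.mem_image, Finset.mem_univ,
    true_and, Sum.inl.injEq, Prod.mk.injEq, false_or] at this
  obtain ⟨j, rfl, h, -⟩ := this
  exact h.symm

lemma cycleLabelGraph_cliqueFree (s k r : ℕ) (hs : 4 ≤ s) :
    (cycleLabelGraph s k r hs).CliqueFree 3 := by
  have : NeZero s := ⟨by omega⟩
  have h1 : (1 : ZMod s) ≠ 0 := by
    intro h
    have := (ZMod.natCast_eq_zero_iff 1 s).1 (by exact_mod_cast h)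
    have := Nat.le_of_dvd (by norm_num) this
    omega
  have h3 : (3 : ZMod s) ≠ 0 := by
    intro h
    have := (ZMod.natCast_eq_zero_iff 3 s).1 (by exact_mod_cast h)
    have := Nat.le_of_dvd (by norm_num) this
    omega
  intro A hA
  obtain ⟨a, b, c, hab, hac, hbc, -⟩ := is3Clique_iff.1 hA
  rcases a with a | a <;> rcases b with b | b <;> rcases c with c | c <;>
    simp only [cycleLabelGraph] at hab hac hbc
  · rcases hab with ⟨h, -⟩ | ⟨h, -⟩ <;> rcases hac with ⟨h', -⟩ | ⟨h', -⟩ <;>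
      rcases hbc with ⟨h'', -⟩ | ⟨h'', -⟩ <;> grind
  · grind

lemma is3TSystem_cycleLabelGraph (s k r : ℕ) [NeZero s] (hs : 4 ≤ s) :
    Is3TSystem (s + 1) (cycleLabelGraph s k r hs) (Finset.univ.image (labelSet r)) := by
  refine ⟨cycleLabelGraph_cliqueFree s k r hs, ?_, ?_⟩
  · simp only [Finset.mem_image, Finset.mem_univ, true_and]
    rintro _ ⟨x, rfl⟩
    refine ⟨?_, ?_, ?_⟩
    · rw [labelSet, Finset.card_insert_of_notMem (by simp), Finset.card_image_of_injective,
        Finset.card_univ, ZMod.card]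
      intro i j h
      simp only [Sum.inl.injEq, Prod.mk.injEq] at h
      exact h.1
    · simp only [labelSet, Finset.mem_insert, Finset.mem_image, Finset.mem_univ, true_and]
      rintro _ (rfl | ⟨i, rfl⟩) _ (rfl | ⟨j, rfl⟩) h
      · exact (cycleLabelGraph s k r hs).irrefl h
      · exact h
      · exact h
      · rcases h with ⟨h, h'⟩ | ⟨h, h'⟩ <;> dsimp only at h h' <;> subst h <;> exact h' rfl
    · rintro (⟨i, u, v⟩ | j) hv
      · by_cases hx : v = x (i + 1)
        · have hu : x i ≠ u := by
            rintro rfl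
            exact hv (by simp [labelSet, hx])
          refine ⟨.inl (i - 1, x (i - 1), x (i - 1 + 1)), by simp [labelSet], Or.inr ?_⟩
          simpa using hu
        · exact ⟨.inl (i + 1, x (i + 1), x (i + 1 + 1)), by simp [labelSet], Or.inl ⟨rfl, hx⟩⟩
      · refine ⟨.inr 0, by simp [labelSet], Or.inr ⟨rfl, ?_⟩⟩
        rintro rfl
        exact hv (by simp [labelSet])
  · simp only [Finset.mem_image, Finset.mem_univ, true_and]
    rintro _ ⟨x, rfl⟩ _ ⟨y, rfl⟩ -
    exact ⟨.inr 0, by simp [labelSet]⟩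

/-- If `s k² < m` then some `(3,s+1)`-system on `m` vertices has `k^s` sets. -/
lemma exists_is3TSystem_card_eq_pow {s k m : ℕ} (hs : 4 ≤ s) (hm : s * k ^ 2 < m) :
    ∃ (H : SimpleGraph (Fin m)) (F : Finset (Finset (Fin m))),
      Is3TSystem (s + 1) H F ∧ F.card = k ^ s := by
  have : NeZero s := ⟨by omega⟩
  obtain ⟨r, rfl⟩ := Nat.exists_eq_add_of_lt hm
  have hcard : Fintype.card ((ZMod s × Fin k × Fin k) ⊕ Fin (r + 1)) = s * k ^ 2 + r + 1 := by
    simp only [Fintype.card_sum, Fintype.card_prod, ZMod.card, Fintype.card_fin]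
    ring
  refine ⟨_, _, (is3TSystem_cycleLabelGraph s k r hs).map_equiv
    (Fintype.equivFinOfCardEq hcard), ?_⟩
  rw [Finset.card_map, Finset.card_image_of_injective _ (labelSet_injective r), Finset.card_univ,
    Fintype.card_fun, Fintype.card_fin, ZMod.card]

lemma exists_mul_sq_lt_le {s m : ℕ} (hs : 0 < s) (hm : s < m) :
    ∃ k, s * k ^ 2 < m ∧ m ≤ 4 * s * k ^ 2 := by
  set n := (m - 1) / s with hn
  have h1 : 1 ≤ n := (Nat.one_le_div_iff hs).2 (by omega)
  have h2 : s * n ≤ m - 1 := Nat.mul_div_le _ _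
  have h3 : m - 1 < s * (n + 1) := Nat.lt_mul_div_succ _ hs
  have hk : 1 ≤ n.sqrt := Nat.sqrt_pos.2 h1
  have h4 : n.sqrt ^ 2 ≤ n := Nat.sqrt_le' n
  have h5 : n + 1 ≤ (n.sqrt + 1) ^ 2 := Nat.lt_succ_sqrt' n
  refine ⟨n.sqrt, ?_, ?_⟩
  · have := Nat.mul_le_mul_left s h4
    omega
  · have h6 : (n.sqrt + 1) ^ 2 ≤ 4 * n.sqrt ^ 2 := by nlinarith
    have := Nat.mul_le_mul_left s (h5.trans h6)
    rw [show 4 * s * n.sqrt ^ 2 = s * (4 * n.sqrt ^ 2) by ring]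
    omega

/-- For `t ≥ 5`: `m^{(t-1)/2} ≪ s_{3,t}(m) ≪ m^{t-3}`. -/
theorem stmt10 (t : ℕ) (ht : 5 ≤ t) :
    ∃ c C : ℝ, 0 < c ∧ 0 < C ∧ ∃ M : ℕ, ∀ m : ℕ, M ≤ m →
      (∀ (V : Type) [Fintype V] [DecidableEq V] (H : SimpleGraph V) (F : Finset (Finset V)),
        Fintype.card V = m → Is3TSystem t H F →
        (F.card : ℝ) ≤ C * (m : ℝ) ^ ((t : ℝ) - 3)) ∧
      (∃ (H : SimpleGraph (Fin m)) (F : Finset (Finset (Fin m))),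
        Is3TSystem t H F ∧ c * (m : ℝ) ^ (((t : ℝ) - 1) / 2) ≤ (F.card : ℝ)) := by
  obtain ⟨s, rfl⟩ : ∃ s, t = s + 1 := ⟨t - 1, by omega⟩
  have hs : (0 : ℝ) < 4 * s := by
    have : 0 < s := by omega
    positivity
  refine ⟨((4 * s : ℝ) ^ ((s : ℝ) / 2))⁻¹, (s + 1) * 12, by positivity, by positivity, s + 1,
    fun m hm => ⟨?_, ?_⟩⟩
  · intro V _ _ H F hV h
    have hle : (F.card : ℝ) ≤ ((s + 1 : ℕ) * (m ^ (s + 1 - 3) * 12) : ℕ) := by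
      exact_mod_cast hV ▸ h.card_le (by omega)
    have hexp : ((s + 1 : ℕ) : ℝ) - 3 = ((s + 1 - 3 : ℕ) : ℝ) := by
      rw [Nat.cast_sub (by omega)]
      norm_num
    rw [hexp, Real.rpow_natCast]
    refine hle.trans (le_of_eq ?_)
    push_cast
    ring
  · obtain ⟨k, hk, hk'⟩ := exists_mul_sq_lt_le (s := s) (m := m) (by omega) (by omega)
    obtain ⟨H, F, h, hF⟩ := exists_is3TSystem_card_eq_pow (by omega) hk
    refine ⟨H, F, h, ?_⟩
    rw [hF, show (((s + 1 : ℕ) : ℝ) - 1) / 2 = (s : ℝ) / 2 by push_cast; ring,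
      inv_mul_le_iff₀ (by positivity)]
    have hkr : (m : ℝ) ≤ 4 * s * (k : ℝ) ^ 2 := by exact_mod_cast hk'
    calc (m : ℝ) ^ ((s : ℝ) / 2) ≤ (4 * s * (k : ℝ) ^ 2) ^ ((s : ℝ) / 2) :=
          Real.rpow_le_rpow (by positivity) hkr (by positivity)
      _ = (4 * s : ℝ) ^ ((s : ℝ) / 2) * ((k ^ s : ℕ) : ℝ) := by
          rw [Real.mul_rpow hs.le (by positivity), ← Real.rpow_natCast (k : ℝ) 2,
            ← Real.rpow_mul (by positivity)]
          congr 1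
          push_cast
          rw [show (2 : ℝ) * (s / 2) = s by ring, Real.rpow_natCast]
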